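/- arXiv:1703.10522 — 4 statements merged into one kernel-verified Lean document; each statement's English description precedes it below -/
import Mathlib

section
/- For all integers m ≥ 0 and n ≥ 0, the Zimin formula with reversal Z_{m,n} is unavoidable. -/
/-!
Formalization framework: a variable alphabet `Σ` is a type `V`; the letter
`(x, false)` represents the variable `x` and `(x, true)` represents its mirror
image `x^R`.  A pattern with reversal is a `List (V × Bool)`, and a formula
with reversal is a set of such patterns (finiteness and nonemptiness of
fragments are taken as hypotheses where relevant).  A morphism respecting
reversal is determined by its values `h : V → List A` on plain variables.
-/

/-- The image of a pattern with reversal under the reversal-respecting extension of `h`. -/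
def applyRev {V A : Type*} (h : V → List A) (p : List (V × Bool)) : List A :=
  p.flatMap fun z => if z.2 then (h z.1).reverse else h z.1

/-- A morphism is non-erasing if it sends no variable to the empty word. -/
def NonErasing {V A : Type*} (h : V → List A) : Prop := ∀ x, h x ≠ []

/-- A formula with reversal `φ` occurs in a finite word `w`. -/
def OccursIn {V A : Type*} (φ : Set (List (V × Bool))) (w : List A) : Prop :=
  ∃ h : V → List A, NonErasing h ∧ ∀ p ∈ φ, applyRev h p <:+: w

/-- A formula with reversal is avoidable: over some finite alphabet,
infinitely many finite words avoid it. -/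
def FAvoidable {V : Type*} (φ : Set (List (V × Bool))) : Prop :=
  ∃ A : Type, Finite A ∧ {w : List A | ¬ OccursIn φ w}.Infinite

/-- The Zimin formulas with reversal `Z_{m,n}`, over the two-way variables
`Sum.inl i` (`i : Fin m`) and the one-way variables `Sum.inr j` (`j < n`):
`Z_{m,0} = x_1^♯ ⋯ x_m^♯` and `Z_{m,n} = Z_{m,n-1} y_n Z_{m,n-1}`. -/
def ZiminRev (m : ℕ) : ℕ → Set (List ((Fin m ⊕ ℕ) × Bool))
  | 0 => {p | ∃ b : Fin m → Bool, p = List.ofFn fun i => (Sum.inl i, b i)}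
  | n + 1 => {p | ∃ u ∈ ZiminRev m n, ∃ v ∈ ZiminRev m n,
      p = u ++ [(Sum.inr n, false)] ++ v}

/-- d-reversal: reverse a word over `Σ ∪ Σ^R` while swapping `x` with `x^R`. -/
def drev {V : Type*} (p : List (V × Bool)) : List (V × Bool) :=
  (p.map fun z => (z.1, !z.2)).reverse

/-- The image of a pattern with reversal under the d-reversal-respecting extension of `h`. -/
def applyDRev {V W : Type*} (h : V → List (W × Bool)) (p : List (V × Bool)) :
    List (W × Bool) :=
  p.flatMap fun z => if z.2 then drev (h z.1) else h z.1

/-- `φ` divides `ψ`: some non-erasing morphism respecting d-reversal sends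
every fragment of `φ` to a factor of a fragment of `ψ`. -/
def FDivides {V W : Type*} (φ : Set (List (V × Bool))) (ψ : Set (List (W × Bool))) : Prop :=
  ∃ h : V → List (W × Bool), NonErasing h ∧ ∀ p ∈ φ, ∃ q ∈ ψ, applyDRev h p <:+: q

/-- The letter `(x,b)` (i.e. `x` if `b = false`, `x^R` if `b = true`) appears in `φ`. -/
def Appears {V : Type*} (φ : Set (List (V × Bool))) (z : V × Bool) : Prop := ∃ p ∈ φ, z ∈ p

/-- `x` is a two-way variable of `φ`: both `x` and `x^R` appear in `φ`. -/
def TwoWay {V : Type*} (φ : Set (List (V × Bool))) (x : V) : Prop :=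
  Appears φ (x, false) ∧ Appears φ (x, true)

/-- `x` is a one-way variable of `φ`: exactly one of `x`, `x^R` appears in `φ`. -/
def OneWay {V : Type*} (φ : Set (List (V × Bool))) (x : V) : Prop :=
  (Appears φ (x, false) ∧ ¬ Appears φ (x, true)) ∨
  (Appears φ (x, true) ∧ ¬ Appears φ (x, false))

/-- The flattening of a pattern with reversal: forget all mirror images. -/
def flatten {V : Type*} (p : List (V × Bool)) : List V := p.map Prod.fst

/-- A finite word is a factor of an ω-word. -/
def InfFactor {A : Type*} (u : List A) (w : ℕ → A) : Prop :=
  ∃ i : ℕ, u = (List.range u.length).map fun j => w (i + j)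

/-- A formula with reversal occurs in an ω-word. -/
def OccursInInf {V A : Type*} (φ : Set (List (V × Bool))) (w : ℕ → A) : Prop :=
  ∃ h : V → List A, NonErasing h ∧ ∀ p ∈ φ, InfFactor (applyRev h p) w

/-- The image of a word (without reversal) under the extension of `h : Σ → A^*`. -/
def applyW {V A : Type*} (h : V → List A) (p : List V) : List A := p.flatMap h

/-- A formula without reversal occurs in a finite word. -/
def OccursInW {V A : Type*} (ψ : Set (List V)) (w : List A) : Prop :=
  ∃ h : V → List A, NonErasing h ∧ ∀ p ∈ ψ, applyW h p <:+: w

/-- A formula without reversal is avoidable. -/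
def WAvoidable {V : Type*} (ψ : Set (List V)) : Prop :=
  ∃ A : Type, Finite A ∧ {w : List A | ¬ OccursInW ψ w}.Infinite

/-- Over a finite alphabet, every sufficiently long word contains two nonadjacent, nonoverlapping
occurrences of some word of length `N`. -/
lemma exists_repeated_infix (A : Type*) [Finite A] (N : ℕ) :
    ∃ M : ℕ, ∀ w : List A, M ≤ w.length →
      ∃ B z : List A, B.length = N ∧ z ≠ [] ∧ B ++ z ++ B <:+: w := by
  have hfin : {l : List A | l.length = N}.Finite := List.finite_length_eq A N
  set K := hfin.toFinset.card with hK
  refine ⟨(K + 1) * (N + 1), fun w hw => ?_⟩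
  have hbound : ∀ i < K + 1, i * (N + 1) + N < w.length := fun i hi => by
    have := Nat.mul_le_mul_right (N + 1) (Nat.succ_le_of_lt hi)
    rw [Nat.succ_mul] at this
    omega
  have hlen : ∀ i < K + 1, ((w.drop (i * (N + 1))).take N).length = N := fun i hi => by
    have := hbound i hi
    simp only [List.length_take, List.length_drop]
    omega
  have key : ∀ i j, i < j → j < K + 1 →
      (w.drop (i * (N + 1))).take N = (w.drop (j * (N + 1))).take N →
      ∃ B z : List A, B.length = N ∧ z ≠ [] ∧ B ++ z ++ B <:+: w := by
    intro i j hij hj heq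
    have hb := hbound j hj
    have hab : i * (N + 1) + N < j * (N + 1) := by
      have := Nat.mul_le_mul_right (N + 1) (Nat.succ_le_of_lt hij)
      rw [Nat.succ_mul] at this
      omega
    set a := i * (N + 1)
    obtain ⟨d, hd⟩ := Nat.exists_eq_add_of_lt hab
    rw [hd] at heq hb
    refine ⟨(w.drop a).take N, (w.drop (a + N)).take (d + 1), hlen i (by omega), ?_,
      w.take a, w.drop (a + N + (d + 1) + N), ?_⟩
    · rw [← List.length_pos_iff]
      simp only [List.length_take, List.length_drop]
      omega
    · have split : ∀ b k, w.drop b = (w.drop b).take k ++ w.drop (b + k) := fun b k => by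
        rw [← List.drop_drop, List.take_append_drop]
      conv_rhs => rw [← List.take_append_drop a w, split a N, split (a + N) (d + 1),
        split (a + N + (d + 1)) N]
      rw [heq]
      simp [add_assoc]
  obtain ⟨i, hi, j, hj, hne, heq⟩ := Finset.exists_ne_map_eq_of_card_lt_of_maps_to
    (s := Finset.range (K + 1)) (t := hfin.toFinset)
    (f := fun i => (w.drop (i * (N + 1))).take N) (by simp [hK])
    (fun i hi => by simpa using hlen i (by simpa using hi))
  simp only [Finset.mem_range] at hi hj
  rcases hne.lt_or_gt with h | h
  · exact key i j h hj heq
  · exact key j i h hi heq.symm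

lemma applyRev_congr {V A : Type*} {g h : V → List A} {p : List (V × Bool)}
    (hgh : ∀ z ∈ p, g z.1 = h z.1) : applyRev g p = applyRev h p := by
  induction p with
  | nil => rfl
  | cons z p ih =>
    simp only [applyRev, List.flatMap_cons] at ih ⊢
    rw [hgh z (by simp), ih fun y hy => hgh y (by simp [hy])]

lemma lt_of_mem_ziminRev {m n j : ℕ} {b : Bool} {p : List ((Fin m ⊕ ℕ) × Bool)}
    (hp : p ∈ ZiminRev m n) (hj : (Sum.inr j, b) ∈ p) : j < n := by
  induction n generalizing p with
  | zero =>
    obtain ⟨c, rfl⟩ := hp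
    simp [List.mem_ofFn] at hj
  | succ n ih =>
    obtain ⟨u, hu, v, hv, rfl⟩ := hp
    simp only [List.mem_append, List.mem_singleton, Prod.mk.injEq, Sum.inr.injEq] at hj
    rcases hj with (hj | hj) | hj
    · exact (ih hu hj).trans n.lt_succ_self
    · omega
    · exact (ih hv hj).trans n.lt_succ_self

/-- Every sufficiently long word has a factor that is simultaneously the image of all fragments
of `Z_{m,n}`: the two-way variables can be sent to single letters, which are palindromes. -/
lemma exists_common_image_ziminRev (A : Type*) [Finite A] (m n : ℕ) :
    ∃ N : ℕ, ∀ w : List A, N ≤ w.length → ∃ h : Fin m ⊕ ℕ → List A, NonErasing h ∧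
      ∃ u, u <:+: w ∧ ∀ p ∈ ZiminRev m n, applyRev h p = u := by
  induction n with
  | zero =>
    refine ⟨m + 1, fun w hw => ⟨Sum.elim (fun i => [w[i.1]]) (fun _ => [w[0]]), ?_,
      w.take m, (List.take_prefix m w).isInfix, ?_⟩⟩
    · rintro (i | j) <;> simp
    · rintro p ⟨b, rfl⟩
      have hletter : (fun i : Fin m => if b i then [w[i.1]].reverse else [w[i.1]]) =
          fun i => [w[i.1]] := by
        funext i
        simp
      simp only [applyRev, List.flatMap, List.map_ofFn, Function.comp_def, Sum.elim_inl, hletter]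
      rw [show List.ofFn (fun i : Fin m => [w[i.1]]) =
        (List.ofFn fun i : Fin m => w[i.1]).map fun a => [a] by simp [Function.comp_def],
        ← List.flatMap_def, List.flatMap_singleton']
      exact List.ext_getElem (by simp; omega) (by simp)
  | succ n ih =>
    obtain ⟨N, hN⟩ := ih
    obtain ⟨M, hM⟩ := exists_repeated_infix A N
    refine ⟨M, fun w hw => ?_⟩
    obtain ⟨B, z, hB, hz, hBw⟩ := hM w hw
    obtain ⟨h, hne, u, ⟨s, t, hst⟩, hu⟩ := hN B hB.ge
    refine ⟨Function.update h (Sum.inr n) (t ++ z ++ s), fun x => ?_,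
      u ++ (t ++ z ++ s) ++ u, List.IsInfix.trans ⟨s, t, ?_⟩ hBw, ?_⟩
    · by_cases hx : x = Sum.inr n
      · subst hx
        simp [hz]
      · simpa [Function.update_of_ne hx] using hne x
    · simp [← hst]
    · rintro p ⟨q, hq, r, hr, rfl⟩
      have hupd : ∀ q ∈ ZiminRev m n,
          applyRev (Function.update h (Sum.inr n) (t ++ z ++ s)) q = u := fun q hq => by
        rw [← hu q hq]
        refine applyRev_congr fun y hy => Function.update_of_ne ?_ _ _
        intro hyn
        obtain ⟨x, b⟩ := y
        subst hyn
        exact (lt_of_mem_ziminRev hq hy).false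
      have happ := hupd q hq
      have happ' := hupd r hr
      simp only [applyRev, List.flatMap_append, List.flatMap_singleton] at happ happ' ⊢
      rw [happ, happ']
      simp

/-- For all `m, n ≥ 0`, the Zimin formula with reversal
`Z_{m,n}` is unavoidable. -/
theorem ziminRev_unavoidable (m n : ℕ) : ¬ FAvoidable (ZiminRev m n) := by
  rintro ⟨A, hA, hinf⟩
  obtain ⟨N, hN⟩ := exists_common_image_ziminRev A m n
  refine hinf ((List.finite_length_lt A N).subset fun w hw => ?_)
  by_contra hlen
  obtain ⟨h, hne, u, huw, hu⟩ := hN w (by simpa using hlen)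
  exact hw ⟨h, hne, fun p hp => hu p hp ▸ huw⟩
end

section
/- Let φ be a formula with reversal. If the flattening φ^♭ is avoidable (as a formula without reversal), then φ is avoidable. -/
/-- Decorate the letters of a word with consecutive residues modulo `3`, starting from `c`. -/
def cyclicTag {A : Type*} : ZMod 3 → List A → List (A × ZMod 3)
  | _, [] => []
  | c, a :: l => (a, c) :: cyclicTag (c + 1) l

theorem map_fst_cyclicTag {A : Type*} (c : ZMod 3) (l : List A) :
    (cyclicTag c l).map Prod.fst = l := by
  induction l generalizing c with
  | nil => rfl
  | cons a l ih => simp [cyclicTag, ih]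

theorem isChain_cyclicTag {A : Type*} (c : ZMod 3) (l : List A) :
    (cyclicTag c l).IsChain fun a b => b.2 = a.2 + 1 := by
  induction l generalizing c with
  | nil => exact List.isChain_nil
  | cons a l ih =>
    cases l with
    | nil => exact List.isChain_singleton _
    | cons b l => exact List.isChain_cons_cons.2 ⟨rfl, ih (c + 1)⟩

/-- A word whose reversal also occurs in a tagged word has length at most one. -/
theorem reverse_eq_of_infix_cyclicTag {A : Type*} {c : ZMod 3} {l : List A}
    {u : List (A × ZMod 3)} (hu : u <:+: cyclicTag c l) (hr : u.reverse <:+: cyclicTag c l) :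
    u.reverse = u := by
  have h₁ := (isChain_cyclicTag c l).infix hu
  have h₂ := List.isChain_reverse.1 ((isChain_cyclicTag c l).infix hr)
  match u, h₁, h₂ with
  | [], _, _ => rfl
  | [_], _, _ => rfl
  | a :: b :: _, h₁, h₂ =>
    have hab : b.2 = a.2 + 1 := (List.isChain_cons_cons.1 h₁).1
    have hba : a.2 = b.2 + 1 := (List.isChain_cons_cons.1 h₂).1
    have key : ∀ x y : ZMod 3, y = x + 1 → x ≠ y + 1 := by decide
    exact absurd hba (key _ _ hab)

theorem infix_applyRev {V A : Type*} (h : V → List A) {p : List (V × Bool)} {z : V × Bool}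
    (hz : z ∈ p) : (if z.2 then (h z.1).reverse else h z.1) <:+: applyRev h p :=
  by
  rw [applyRev, List.flatMap_def]
  exact List.infix_of_mem_flatten (List.mem_map_of_mem hz)

theorem OccursIn.flatten_of_cyclicTag {V A : Type*} {φ : Set (List (V × Bool))} {c : ZMod 3}
    {w : List A} (hφ : OccursIn φ (cyclicTag c w)) : OccursInW (flatten '' φ) w := by
  classical
  obtain ⟨h, hne, hocc⟩ := hφ
  let g : V → List (A × ZMod 3) := fun x => if Appears φ (x, true) then (h x).reverse else h x
  have hg : ∀ p ∈ φ, applyW g (flatten p) = applyRev h p := by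
    intro p hp
    simp only [applyW, flatten, applyRev, List.flatMap_map]
    refine List.flatMap_congr fun z hz => ?_
    obtain ⟨x, b⟩ := z
    cases b with
    | true => simp [g, show Appears φ (x, true) from ⟨p, hp, hz⟩]
    | false =>
      by_cases hx : Appears φ (x, true)
      · obtain ⟨q, hq, hxq⟩ := id hx
        have h₁ : h x <:+: cyclicTag c w := (infix_applyRev h hz).trans (hocc p hp)
        have h₂ : (h x).reverse <:+: cyclicTag c w := (infix_applyRev h hxq).trans (hocc q hq)
        simpa [g, hx] using reverse_eq_of_infix_cyclicTag h₁ h₂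
      · simp [g, hx]
  refine ⟨fun x => (g x).map Prod.fst, fun x => ?_, ?_⟩
  · have := hne x
    by_cases hx : Appears φ (x, true) <;> simp [g, hx, this]
  · rintro _ ⟨p, hp, rfl⟩
    have := (hocc p hp).map Prod.fst
    rw [map_fst_cyclicTag, ← hg p hp] at this
    simpa [applyW, List.map_flatMap] using this

/-- If the flattening `φ^♭` is avoidable (as a formula without
reversal), then `φ` is avoidable. -/
theorem avoidable_of_flatten_avoidable {V : Type*} (φ : Set (List (V × Bool)))
    (hfin : φ.Finite) (hfrag : ∀ p ∈ φ, p ≠ [])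
    (hflat : WAvoidable (flatten '' φ)) : FAvoidable φ := by
  obtain ⟨A, _, hinf⟩ := hflat
  refine ⟨A × ZMod 3, inferInstance, ?_⟩
  have hinj : Function.Injective (cyclicTag (A := A) 0) :=
    Function.LeftInverse.injective (map_fst_cyclicTag 0)
  refine (hinf.image hinj.injOn).mono ?_
  rintro _ ⟨w, hw, rfl⟩ hocc
  exact hw hocc.flatten_of_cyclicTag
end

section
/- Let φ be a formula with reversal having at least one one-way variable. If for every one-way variable y of φ there is a factor f_y of φ in which y (respectively y^R, whichever of the two appears in φ) appears twice, then φ is avoidable. -/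
/-- A word is `k`-sparse if it has no factor `v u v` with `v` nonempty and `|u| ≤ k |v|`. -/
def Sparse {A : Type*} (k : ℕ) (w : List A) : Prop :=
  ∀ v u : List A, v ≠ [] → u.length ≤ k * v.length → ¬ v ++ u ++ v <:+: w

theorem Sparse.of_infix {A : Type*} {k : ℕ} {w w' : List A} (hw : Sparse k w)
    (h : w' <:+: w) : Sparse k w' :=
  fun v u hv hu hf => hw v u hv hu (hf.trans h)

/-- A word that stops being `k`-sparse when a letter is prepended is determined, after that
letter is added, by a proper suffix together with the length and the gap of the repetition. -/
theorem Sparse.exists_cons_eq {A : Type*} {k : ℕ} {w : List A} (hw : Sparse k w) {c : A}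
    (hc : ¬ Sparse k (c :: w)) :
    ∃ l < w.length + 1, ∃ m < k * (l + 1) + 1, ∃ w' : List A, Sparse k w' ∧
      w'.length = w.length - l ∧ c :: w = (w'.drop m).take (l + 1) ++ w' := by
  unfold Sparse at hc
  push Not at hc
  obtain ⟨v, u, hv, hu, hf⟩ := hc
  rcases List.infix_cons_iff.1 hf with ⟨t, ht⟩ | hf
  · obtain ⟨l, hl⟩ : ∃ l, v.length = l + 1 :=
      Nat.exists_eq_succ_of_ne_zero (by simpa using hv)
    have hlen := congrArg List.length ht
    simp only [List.length_append, List.length_cons] at hlen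
    refine ⟨l, by omega, u.length, by rw [hl] at hu; omega, u ++ v ++ t, ?_, ?_, ?_⟩
    · refine hw.of_infix (List.IsSuffix.isInfix ?_)
      obtain ⟨d, v', rfl⟩ := List.exists_cons_of_ne_nil hv
      simp only [List.cons_append, List.cons.injEq] at ht
      exact ⟨v', by rw [← ht.2]; simp⟩
    · simp only [List.length_append]
      omega
    · rw [← ht, ← hl]
      simp
  · exact absurd hf (hw v u hv hu)

open Classical in
/-- The `k`-sparse words of length `n` over `A`. -/
noncomputable def sparseWords (A : Type*) [Fintype A] (k : ℕ) : ℕ → Finset (List A)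
  | 0 => {[]}
  | n + 1 => ((Finset.univ ×ˢ sparseWords A k n).image fun q : A × List A => q.1 :: q.2).filter
      (Sparse k)

theorem mem_sparseWords {A : Type*} [Fintype A] {k n : ℕ} {w : List A} :
    w ∈ sparseWords A k n ↔ w.length = n ∧ Sparse k w := by
  induction n generalizing w with
  | zero =>
    simp only [sparseWords, Finset.mem_singleton, List.length_eq_zero_iff]
    refine ⟨fun h => ⟨h, ?_⟩, And.left⟩
    subst h
    intro v u hv _ hf
    simp_all
  | succ n ih =>
    simp only [sparseWords, Finset.mem_filter, Finset.mem_image, Finset.mem_product,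
      Finset.mem_univ, true_and, Prod.exists]
    constructor
    · rintro ⟨⟨c, w', hw', rfl⟩, hs⟩
      exact ⟨by simp [(ih.1 hw').1], hs⟩
    · rintro ⟨hl, hs⟩
      obtain ⟨c, w', rfl⟩ := List.exists_cons_of_length_eq_add_one hl
      exact ⟨⟨c, w', ih.2 ⟨by simpa using hl, hs.of_infix (List.suffix_cons c w').isInfix⟩, rfl⟩,
        hs⟩

open Classical in
theorem card_mul_card_sparseWords_le (A : Type*) [Fintype A] (k n : ℕ) :
    Fintype.card A * (sparseWords A k n).card ≤ (sparseWords A k (n + 1)).card +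
      ∑ l ∈ Finset.range (n + 1), (k * (l + 1) + 1) * (sparseWords A k (n - l)).card := by
  set T := (Finset.univ ×ˢ sparseWords A k n).image fun q : A × List A => q.1 :: q.2 with hT
  have hTcard : T.card = Fintype.card A * (sparseWords A k n).card := by
    rw [hT, Finset.card_image_of_injective, Finset.card_product, Finset.card_univ]
    rintro ⟨c, w⟩ ⟨c', w'⟩ h
    simpa using h
  have hbad : T.filter (fun w => ¬ Sparse k w) ⊆
      (Finset.range (n + 1)).biUnion fun l => (Finset.range (k * (l + 1) + 1)).biUnion fun m =>
        (sparseWords A k (n - l)).image fun w => (w.drop m).take (l + 1) ++ w := by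
    intro x hx
    simp only [hT, Finset.mem_filter, Finset.mem_image, Finset.mem_product, Finset.mem_univ,
      true_and, Prod.exists] at hx
    obtain ⟨⟨c, w, hw, rfl⟩, hs⟩ := hx
    obtain ⟨rfl, hsw⟩ := mem_sparseWords.1 hw
    obtain ⟨l, hl, m, hm, w', hw', hlen, heq⟩ := hsw.exists_cons_eq hs
    simp only [Finset.mem_biUnion, Finset.mem_range, Finset.mem_image]
    exact ⟨l, hl, m, hm, w', mem_sparseWords.2 ⟨hlen, hw'⟩, heq.symm⟩
  rw [← hTcard, ← Finset.card_filter_add_card_filter_not (s := T) (Sparse k)]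
  refine Nat.add_le_add le_rfl ((Finset.card_le_card hbad).trans ?_)
  refine Finset.card_biUnion_le.trans (Finset.sum_le_sum fun l _ => ?_)
  refine (Finset.card_biUnion_le_card_mul _ _ _ fun m _ => Finset.card_image_le).trans ?_
  rw [Finset.card_range]

/-- A sequence that doubles up to index `n` dominates its linearly weighted convolution. -/
theorem sum_linear_mul_le_of_doubling (k n : ℕ) (C : ℕ → ℕ)
    (hC : ∀ j < n, 2 * C j ≤ C (j + 1)) :
    ∑ l ∈ Finset.range (n + 1), (k * (l + 1) + 1) * C (n - l) ≤ (4 * k + 2) * C n := by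
  have key : ∀ N ≤ n, ∑ l ∈ Finset.range N, (k * (l + 1) + 1) * C (n - l) +
      (2 * k * N + 4 * k + 2) * C (n - N) ≤ (4 * k + 2) * C n := by
    intro N
    induction N with
    | zero => intro _; simp
    | succ N ih =>
      intro hN
      refine le_trans ?_ (ih (by omega))
      have h := hC (n - (N + 1)) (by omega)
      rw [show n - (N + 1) + 1 = n - N by omega] at h
      rw [Finset.sum_range_succ]
      nlinarith [Nat.mul_le_mul_left (k * N + 3 * k + 1) h]
  have h := key n le_rfl
  rw [Finset.sum_range_succ]
  nlinarith [Nat.zero_le (k * n * C (n - n)), Nat.zero_le (k * C (n - n)),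
    Nat.zero_le (C (n - n))]

theorem two_mul_card_sparseWords_le {A : Type*} [Fintype A] {k : ℕ}
    (hA : 4 * k + 4 ≤ Fintype.card A) (n : ℕ) :
    2 * (sparseWords A k n).card ≤ (sparseWords A k (n + 1)).card := by
  induction n using Nat.strong_induction_on with
  | _ n ih =>
    have h₁ := card_mul_card_sparseWords_le A k n
    have h₂ := sum_linear_mul_le_of_doubling k n (fun j => (sparseWords A k j).card) ih
    have h₃ := Nat.mul_le_mul_right (sparseWords A k n).card hA
    linarith

theorem exists_sparse_of_card {A : Type*} [Fintype A] {k : ℕ}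
    (hA : 4 * k + 4 ≤ Fintype.card A) (n : ℕ) :
    ∃ w : List A, w.length = n ∧ Sparse k w := by
  have hpos : 0 < (sparseWords A k n).card := by
    induction n with
    | zero => simp [sparseWords]
    | succ n ih => have := two_mul_card_sparseWords_le hA n; omega
  obtain ⟨w, hw⟩ := Finset.card_pos.1 hpos
  exact ⟨w, mem_sparseWords.1 hw⟩

/-- Label the letters of a word by their positions modulo 3, starting from `s`. -/
def tagMod {A : Type*} : ZMod 3 → List A → List (A × ZMod 3)
  | _, [] => []
  | s, c :: w => (c, s) :: tagMod (s + 1) w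

theorem map_fst_tagMod {A : Type*} (s : ZMod 3) (w : List A) :
    (tagMod s w).map Prod.fst = w := by
  induction w generalizing s with
  | nil => rfl
  | cons c w ih => simp [tagMod, ih]

theorem isChain_tagMod {A : Type*} (s : ZMod 3) (w : List A) :
    (tagMod s w).IsChain fun x y => y.2 = x.2 + 1 := by
  induction w generalizing s with
  | nil => exact List.isChain_nil
  | cons c w ih =>
    cases w with
    | nil => exact List.isChain_singleton _
    | cons d w => exact List.isChain_cons_cons.2 ⟨rfl, ih (s + 1)⟩

theorem length_le_one_of_infix_reverse_infix {A : Type*} {s : ZMod 3} {w : List A}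
    {v : List (A × ZMod 3)} (h₁ : v <:+: tagMod s w) (h₂ : v.reverse <:+: tagMod s w) :
    v.length ≤ 1 := by
  have c₁ := (isChain_tagMod s w).infix h₁
  have c₂ := List.isChain_reverse.1 ((isChain_tagMod s w).infix h₂)
  match v, c₁, c₂ with
  | [], _, _ => simp
  | [_], _, _ => simp
  | x :: y :: _, c₁, c₂ =>
    have e₁ := (List.isChain_cons_cons.1 c₁).1
    have e₂ := (List.isChain_cons_cons.1 c₂).1
    rw [e₁] at e₂
    exact absurd e₂ ((by decide : ∀ t : ZMod 3, t ≠ t + 1 + 1) x.2)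

theorem sparse_of_map {A B : Type*} {k : ℕ} (g : A → B) {w : List A}
    (h : Sparse k (w.map g)) : Sparse k w :=
  fun v u hv hu hf => h (v.map g) (u.map g) (by simpa using hv) (by simpa using hu)
    (by simpa using hf.map g)

theorem List.exists_eq_append_of_two_le_count {α : Type*} [BEq α] [LawfulBEq α] {z : α} {f : List α}
    (h : 2 ≤ f.count z) : ∃ a b c, f = a ++ z :: (b ++ z :: c) := by
  obtain ⟨a, t, rfl, ha⟩ :=
    List.eq_append_cons_of_mem (List.count_pos_iff.1 (by omega : 0 < f.count z))
  rw [List.count_append, List.count_eq_zero.2 ha, List.count_cons_self] at h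
  obtain ⟨b, c, rfl⟩ := List.append_of_mem (List.count_pos_iff.1 (by omega : 0 < t.count z))
  exact ⟨a, b, c, rfl⟩

theorem applyRev_append {V A : Type*} (h : V → List A) (p q : List (V × Bool)) :
    applyRev h (p ++ q) = applyRev h p ++ applyRev h q := by
  simp [applyRev]

theorem applyRev_cons {V A : Type*} (h : V → List A) (z : V × Bool) (p : List (V × Bool)) :
    applyRev h (z :: p) = (if z.2 then (h z.1).reverse else h z.1) ++ applyRev h p := by
  simp [applyRev]

theorem applyRev_infix {V A : Type*} (h : V → List A) {p q : List (V × Bool)} (hpq : p <:+: q) :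
    applyRev h p <:+: applyRev h q := by
  obtain ⟨s, t, rfl⟩ := hpq
  exact ⟨applyRev h s, applyRev h t, by simp [applyRev_append]⟩

theorem length_applyRev_le {V A : Type*} (h : V → List A) {L : ℕ} {p : List (V × Bool)}
    (hp : ∀ z ∈ p, (h z.1).length ≤ L) : (applyRev h p).length ≤ p.length * L := by
  induction p with
  | nil => simp [applyRev]
  | cons z p ih =>
    have h₁ := hp z (by simp)
    have h₂ := ih fun y hy => hp y (List.mem_cons_of_mem _ hy)
    rw [applyRev_cons, List.length_append, List.length_cons, add_mul]
    split
    · rw [List.length_reverse]; omega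
    · omega

theorem not_occursIn_of_sparse {V A : Type*} [DecidableEq V] {φ : Set (List (V × Bool))} {k : ℕ}
    (hk : ∀ p ∈ φ, p.length ≤ k) (hone : ∃ x : V, OneWay φ x)
    (hrep : ∀ (x : V) (b : Bool), Appears φ (x, b) → ¬ Appears φ (x, !b) →
      ∃ p ∈ φ, ∃ f : List (V × Bool), f <:+: p ∧ 2 ≤ f.count (x, b))
    {W : List A} (hW : Sparse k W)
    (hrev : ∀ v : List A, v <:+: W → v.reverse <:+: W → v.length ≤ 1) :
    ¬ OccursIn φ W := by
  rintro ⟨h, hne, hocc⟩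
  have himg : ∀ z : V × Bool, Appears φ z →
      (if z.2 then (h z.1).reverse else h z.1) <:+: W := by
    rintro z ⟨p, hp, hz⟩
    have h₁ := applyRev_infix h ((List.singleton_infix_iff z p).2 hz)
    rw [applyRev_cons] at h₁
    simpa [applyRev] using h₁.trans (hocc p hp)
  have hlen : ∀ z : V × Bool, Appears φ z → (h z.1).length ≤ W.length := by
    intro z hz
    have := (himg z hz).length_le
    split at this <;> simpa using this
  -- A one-way variable whose image has maximal length.
  obtain ⟨y, hy, hmax⟩ : ∃ y, OneWay φ y ∧ ∀ x, OneWay φ x → (h x).length ≤ (h y).length := by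
    have hbdd : BddAbove ((fun x => (h x).length) '' {x | OneWay φ x}) := by
      refine ⟨W.length, ?_⟩
      rintro _ ⟨x, hx | hx, rfl⟩
      · exact hlen (x, false) hx.1
      · exact hlen (x, true) hx.1
    obtain ⟨x₀, hx₀⟩ := hone
    obtain ⟨y, hy, hyeq⟩ := Nat.sSup_mem (Set.Nonempty.image _ ⟨x₀, hx₀⟩) hbdd
    exact ⟨y, hy, fun x hx => (le_csSup hbdd (Set.mem_image_of_mem _ hx)).trans hyeq.ge⟩
  have hall : ∀ z : V × Bool, Appears φ z → (h z.1).length ≤ (h y).length := by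
    rintro ⟨x, b⟩ hz
    by_cases hz' : Appears φ (x, !b)
    · have h₁ : (h x).length ≤ 1 := by
        cases b
        · exact hrev _ (by simpa using himg _ hz) (by simpa using himg _ hz')
        · exact hrev _ (by simpa using himg _ hz') (by simpa using himg _ hz)
      exact h₁.trans (List.length_pos_iff.2 (hne y))
    · refine hmax x ?_
      cases b
      · exact Or.inl ⟨hz, hz'⟩
      · exact Or.inr ⟨hz, hz'⟩
  obtain ⟨b, hb, hb'⟩ : ∃ b, Appears φ (y, b) ∧ ¬ Appears φ (y, !b) :=
    hy.elim (fun h => ⟨false, h⟩) fun h => ⟨true, h⟩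
  obtain ⟨p, hp, f, hf, hcount⟩ := hrep y b hb hb'
  obtain ⟨s, m, t, rfl⟩ := List.exists_eq_append_of_two_le_count hcount
  have hmp : m <:+: p :=
    List.IsInfix.trans ⟨s ++ [(y, b)], (y, b) :: t, by simp⟩ hf
  have hmlen := length_applyRev_le h fun z hz => hall z ⟨p, hp, hmp.subset hz⟩
  have hinf : [(y, b)] ++ m ++ [(y, b)] <:+: p := List.IsInfix.trans ⟨s, t, by simp⟩ hf
  have hinf' := (applyRev_infix h hinf).trans (hocc p hp)
  rw [applyRev_append, applyRev_append] at hinf'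
  have hylen : (applyRev h [(y, b)]).length = (h y).length := by
    cases b <;> simp [applyRev]
  refine hW _ _ (fun h0 => hne y ?_) ?_ hinf'
  · rw [← List.length_eq_zero_iff, ← hylen, h0, List.length_nil]
  · rw [hylen]
    exact hmlen.trans (Nat.mul_le_mul_right _ (hmp.length_le.trans (hk p hp)))

/-- If `φ` has at least one one-way variable, and for each one-way
variable `y` there is a factor of `φ` in which (the appearing one of) `y`, `y^R`
appears twice, then `φ` is avoidable. -/
theorem avoidable_of_oneWay_twice {V : Type*} [DecidableEq V]
    (φ : Set (List (V × Bool))) (hfin : φ.Finite) (hfrag : ∀ p ∈ φ, p ≠ [])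
    (hone : ∃ x : V, OneWay φ x)
    (hrep : ∀ (x : V) (b : Bool), Appears φ (x, b) → ¬ Appears φ (x, !b) →
      ∃ p ∈ φ, ∃ f : List (V × Bool), f <:+: p ∧ 2 ≤ f.count (x, b)) :
    FAvoidable φ := by
  obtain ⟨k, hk⟩ := (hfin.image List.length).bddAbove
  have hA : 4 * k + 4 ≤ Fintype.card (Fin (4 * k + 4)) := by simp
  choose w hwlen hw using exists_sparse_of_card hA
  have hlen : ∀ n, (tagMod 0 (w n)).length = n := fun n => by
    rw [← List.length_map Prod.fst, map_fst_tagMod, hwlen]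
  refine ⟨Fin (4 * k + 4) × ZMod 3, inferInstance, Set.infinite_of_injective_forall_mem
    (f := fun n => tagMod 0 (w n)) (fun m n hmn => ?_) fun n => ?_⟩
  · rw [← hlen m, ← hlen n]
    exact congrArg List.length hmn
  · exact not_occursIn_of_sparse (fun p hp => hk (Set.mem_image_of_mem _ hp)) hone hrep
      (sparse_of_map Prod.fst (by rw [map_fst_tagMod]; exact hw n))
      fun v => length_le_one_of_infix_reverse_infix
end

section
/- Let φ be a formula with reversal over Σ and let y be a two-way variable in φ. If there exist variables x, z ∈ Σ such that xy, yz, and xz are all factors of the flattening φ^♭, then φ is avoidable; indeed, the periodic ω-word (123)^ω avoids φ. -/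
/-- A word over `Fin 3` in which every letter is followed by its cyclic successor. -/
abbrev IsCyclicWord (l : List (Fin 3)) : Prop := l.IsChain fun a b => b = a + 1

theorem isCyclicWord_map_range (i n : ℕ) :
    IsCyclicWord ((List.range n).map fun j =>
      (⟨(i + j) % 3, Nat.mod_lt (i + j) (by norm_num)⟩ : Fin 3)) := by
  rw [IsCyclicWord, List.isChain_iff_getElem]
  intro k hk
  simp only [List.getElem_map, List.getElem_range, Fin.ext_iff, Fin.val_add, Fin.val_one]
  omega

theorem reverse_eq_self_of_isCyclicWord {l : List (Fin 3)} (hl : IsCyclicWord l)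
    (hr : IsCyclicWord l.reverse) : l.reverse = l ∧ l.length ≤ 1 := by
  rcases l with _ | ⟨a, _ | ⟨b, t⟩⟩
  · simp
  · simp
  · exfalso
    have h₁ : b = a + 1 := (List.isChain_cons_cons.1 hl).1
    have h₂ : a = b + 1 := (List.isChain_cons_cons.1 (List.isChain_reverse.1 hr)).1
    clear hl hr
    revert a b
    decide

theorem applyRev_letter_eq_of_isCyclicWord {V : Type*} {h : V → List (Fin 3)} {v : V} {b b' : Bool}
    (hb : IsCyclicWord (applyRev h [(v, b)])) (hb' : IsCyclicWord (applyRev h [(v, b')])) :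
    applyRev h [(v, b)] = applyRev h [(v, b')] := by
  cases b <;> cases b' <;> simp only [applyRev, List.flatMap_cons, List.flatMap_nil,
    List.append_nil, if_true, Bool.false_eq_true, if_false] at hb hb' ⊢
  · exact (reverse_eq_self_of_isCyclicWord hb hb').1.symm
  · exact (reverse_eq_self_of_isCyclicWord hb' hb).1

theorem exists_infix_of_pair_infix_flatten {V : Type*} {p : List (V × Bool)} {u v : V}
    (huv : [u, v] <:+: flatten p) : ∃ b c, [(u, b), (v, c)] <:+: p := by
  obtain ⟨s, t, hst⟩ := huv
  obtain ⟨q, t', rfl, hq, -⟩ := List.map_eq_append_iff.1 hst.symm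
  obtain ⟨s', m, rfl, -, hm⟩ := List.map_eq_append_iff.1 hq
  match m, hm with
  | [(_, b), (_, c)], hm =>
    obtain ⟨rfl, rfl⟩ : _ = u ∧ _ = v := by simpa using hm
    exact ⟨b, c, s', t', rfl⟩

theorem not_forall_isCyclicWord_applyRev {V : Type*} {φ : Set (List (V × Bool))} {x y z : V}
    (hy : TwoWay φ y)
    (hxy : ∃ p ∈ φ, [x, y] <:+: flatten p)
    (hyz : ∃ p ∈ φ, [y, z] <:+: flatten p)
    (hxz : ∃ p ∈ φ, [x, z] <:+: flatten p)
    {h : V → List (Fin 3)} (hne : NonErasing h) :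
    ¬ ∀ p ∈ φ, IsCyclicWord (applyRev h p) := by
  intro hφ
  have pair : ∀ {u v : V}, (∃ p ∈ φ, [u, v] <:+: flatten p) → ∃ b c,
      IsCyclicWord (applyRev h [(u, b)] ++ applyRev h [(v, c)]) := by
    rintro u v ⟨p, hp, huv⟩
    obtain ⟨b, c, hbc⟩ := exists_infix_of_pair_infix_flatten huv
    refine ⟨b, c, ?_⟩
    simpa [applyRev] using (hφ p hp).infix (applyRev_infix h hbc)
  have letter : ∀ {v : V} {b : Bool}, Appears φ (v, b) → IsCyclicWord (applyRev h [(v, b)]) := by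
    rintro v b ⟨p, hp, hv⟩
    exact (hφ p hp).infix (applyRev_infix h (List.singleton_infix_iff _ _ |>.2 hv))
  have ne_nil : ∀ v b, applyRev h [(v, b)] ≠ [] := by
    intro v b
    cases b <;> simpa [applyRev] using hne v
  have hy₀ := letter hy.1
  have hy₁ := letter hy.2
  obtain ⟨c, hc⟩ : ∃ c, h y = [c] := by
    rw [← List.length_eq_one_iff]
    have hle := (reverse_eq_self_of_isCyclicWord (l := h y) (by simpa [applyRev] using hy₀)
      (by simpa [applyRev] using hy₁)).2
    have hpos := List.length_pos_iff.2 (hne y)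
    omega
  have hyc : ∀ b, applyRev h [(y, b)] = [c] := by
    intro b
    cases b <;> simp [applyRev, hc]
  obtain ⟨bx, _, h₁⟩ := pair hxy
  obtain ⟨_, cz, h₂⟩ := pair hyz
  obtain ⟨_, _, h₃⟩ := pair hxz
  rw [applyRev_letter_eq_of_isCyclicWord h₃.left_of_append h₁.left_of_append,
    applyRev_letter_eq_of_isCyclicWord h₃.right_of_append h₂.right_of_append] at h₃
  rw [hyc] at h₁ h₂
  obtain ⟨X, a, hX⟩ := List.eq_nil_or_concat' (applyRev h [(x, bx)]) |>.resolve_left (ne_nil _ _)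
  obtain ⟨d, Z, hZ⟩ := List.exists_cons_of_ne_nil (ne_nil z cz)
  rw [hX] at h₁ h₃
  rw [hZ] at h₂ h₃
  have e₁ : c = a + 1 := (List.isChain_append.1 h₁).2.2 a (by simp) c (by simp)
  have e₂ : d = c + 1 := (List.isChain_append.1 h₂).2.2 c (by simp) d (by simp)
  have e₃ : d = a + 1 := (List.isChain_append.1 h₃).2.2 a (by simp) d (by simp)
  clear hc hyc hX hZ h₁ h₂ h₃
  revert a c d
  decide

/-- If `y` is two-way in `φ` and `xy`, `yz`, `xz` are all factors of
the flattening `φ^♭`, then the periodic ω-word `(123)^ω` avoids `φ`; in particular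
`φ` is avoidable. -/
theorem avoidable_of_twoWay_middle {V : Type*}
    (φ : Set (List (V × Bool))) (hfin : φ.Finite) (hfrag : ∀ p ∈ φ, p ≠ [])
    (y : V) (hy : TwoWay φ y) (x z : V)
    (hxy : ∃ p ∈ φ, [x, y] <:+: flatten p)
    (hyz : ∃ p ∈ φ, [y, z] <:+: flatten p)
    (hxz : ∃ p ∈ φ, [x, z] <:+: flatten p) :
    ¬ OccursInInf φ (fun i : ℕ => (⟨i % 3, Nat.mod_lt i (by norm_num)⟩ : Fin 3)) ∧
      FAvoidable φ := by
  refine ⟨?_, Fin 3, inferInstance, ?_⟩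
  · rintro ⟨h, hne, hocc⟩
    refine not_forall_isCyclicWord_applyRev hy hxy hyz hxz hne fun p hp => ?_
    obtain ⟨i, hi⟩ := hocc p hp
    rw [hi]
    exact isCyclicWord_map_range i _
  · refine Set.infinite_of_injective_forall_mem (f := fun n : ℕ => (List.range n).map fun j =>
      (⟨(0 + j) % 3, Nat.mod_lt (0 + j) (by norm_num)⟩ : Fin 3)) ?_ ?_
    · intro m n hmn
      simpa using congrArg List.length hmn
    · rintro n ⟨h, hne, hocc⟩
      exact not_forall_isCyclicWord_applyRev hy hxy hyz hxz hne fun p hp =>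
        (isCyclicWord_map_range 0 n).infix (hocc p hp)
end
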